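/- Fix N ≥ 4 and a symmetric function m assigning to each unordered pair {i, j} of distinct indices in {1,…,N} a natural number m_{ij} ≥ 2. Let S be the set of all N×N real matrices A = (a_{ij}) such that: (i) a_{ii} = 2 for all i; (ii) a_{ij} ≤ 0 for all i ≠ j; (iii) a_{ij} = 0 if and only if a_{ji} = 0; (iv) a_{ij} a_{ji} = 4cos²(π/m_{ij}) for all i ≠ j; and (v) every cyclic product of A is an integer, i.e., for every k ≥ 1 and k-tuple (i_1,…,i_k), the real number a_{i_1 i_2} a_{i_2 i_3} ⋯ a_{i_k i_1} lies in the image of ℤ → ℝ. Then S meets only finitely many equivalence classes: there exists a finite set F of N×N real matrices such that every A ∈ S can be written as A = D B D^{-1} for some B ∈ F and some diagonal matrix D with strictly positive diagonal entries. -/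

import Mathlib

open scoped BigOperators

namespace SimpleGraph.Walk

variable {V R : Type*} [CommRing R] {G : SimpleGraph V}

/-- The product of the matrix entries along the edges of a walk. -/
def weight (A : Matrix V V R) : {u v : V} → G.Walk u v → R
  | _, _, nil => 1
  | _, _, cons (u := u) (v := v) _ p => A u v * weight A p

theorem weight_append (A : Matrix V V R) {u v w : V} (p : G.Walk u v) (q : G.Walk v w) :
    (p.append q).weight A = p.weight A * q.weight A := by
  induction p with
  | nil => simp [weight]
  | cons h p ih => simp [weight, ih, mul_assoc]

theorem weight_mul_weight_reverse {A S : Matrix V V R}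
    (hS : ∀ i j, G.Adj i j → A i j * A j i = S i j) {u v : V} (p : G.Walk u v) :
    p.weight A * p.reverse.weight A = p.weight S := by
  induction p with
  | nil => simp [weight]
  | cons h p ih =>
    simp only [reverse_cons, weight_append, weight, ← ih, ← hS _ _ h]
    ring

theorem weight_eq_prod (A : Matrix V V R) {u v : V} (p : G.Walk u v) :
    p.weight A = ∏ i ∈ Finset.range p.length, A (p.getVert i) (p.getVert (i + 1)) := by
  induction p with
  | nil => simp [weight]
  | cons h p ih =>
    rw [length_cons, Finset.prod_range_succ', weight, ih]
    simp [mul_comm]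

theorem weight_closed_eq_prod (A : Matrix V V R) {u : V} (p : G.Walk u u) {k : ℕ}
    (hk : p.length = k + 1) :
    ∃ C : Fin (k + 1) → V, p.weight A = ∏ j : Fin (k + 1), A (C j) (C (j + 1)) := by
  refine ⟨fun j => p.getVert j, ?_⟩
  rw [weight_eq_prod, hk, Finset.prod_range_succ, Fin.prod_univ_castSucc,
    ← Fin.prod_univ_eq_prod_range (fun i => A (p.getVert i) (p.getVert (i + 1)))]
  have hlast : p.getVert (k + 1) = p.getVert 0 := by
    rw [← hk, getVert_length, getVert_zero]
  simp [hlast]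

theorem weight_ne_zero [NoZeroDivisors R] [Nontrivial R] {A : Matrix V V R}
    (hA : ∀ i j, G.Adj i j → A i j ≠ 0) {u v : V} (p : G.Walk u v) : p.weight A ≠ 0 := by
  induction p with
  | nil => simp [weight]
  | cons h p ih => exact mul_ne_zero (hA _ _ h) ih

theorem weight_div_weight_pos {A B : Matrix V V ℝ} (hA : ∀ i j, G.Adj i j → A i j < 0)
    (hB : ∀ i j, G.Adj i j → B i j < 0) {u v : V} (p : G.Walk u v) :
    0 < p.weight B / p.weight A := by
  induction p with
  | nil => simp [weight]
  | cons h p ih =>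
    rw [weight, weight, mul_div_mul_comm]
    exact mul_pos (div_pos_of_neg_of_neg (hB _ _ h) (hA _ _ h)) ih

/-- If all cyclic products of `A` are integers, then so is the weight of the closed walk that
follows `p`, crosses the edge from `i` to `j`, and returns along `q`. -/
theorem exists_int_weight_mul_edge {A : Matrix V V R}
    (hint : ∀ (k : ℕ) (C : Fin (k + 1) → V), ∃ z : ℤ,
      (∏ j : Fin (k + 1), A (C j) (C (j + 1))) = z)
    {a b i j : V} (hab : a = b) (p : G.Walk a i) (h : G.Adj i j) (q : G.Walk b j) :
    ∃ z : ℤ, p.weight A * A i j * q.reverse.weight A = z := by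
  subst hab
  obtain ⟨C, hC⟩ := weight_closed_eq_prod A (p.append (cons h q.reverse))
    (k := p.length + q.length) (by simp; ring)
  obtain ⟨z, hz⟩ := hint _ C
  refine ⟨z, ?_⟩
  rw [← hz, ← hC, weight_append, weight, mul_assoc]

end SimpleGraph.Walk

theorem SimpleGraph.exists_root_walks {V : Type*} (G : SimpleGraph V) :
    ∃ (r : V → V) (_ : ∀ i, G.Walk (r i) i), ∀ i j, G.Adj i j → r i = r j := by
  have hreach : ∀ i, G.Reachable (G.connectedComponentMk i).out i := fun i =>
    ConnectedComponent.exact (Quot.out_eq _)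
  exact ⟨fun i => (G.connectedComponentMk i).out, fun i => (hreach i).some, fun i j h =>
    congrArg Quot.out (ConnectedComponent.sound h.reachable)⟩

theorem abs_int_le_mul_of_ne_zero {x y : ℝ} (hy : y ≠ 0) (hint : ∃ z : ℤ, y = z) :
    |x| ≤ |x * y| := by
  obtain ⟨z, rfl⟩ := hint
  have hz : (1 : ℝ) ≤ |(z : ℝ)| := by
    exact_mod_cast Int.one_le_abs (by exact_mod_cast hy)
  rw [abs_mul]
  exact le_mul_of_one_le_right (abs_nonneg x) hz

theorem finite_setOf_int_abs_le (K : ℝ) : {x : ℝ | (∃ z : ℤ, x = z) ∧ |x| ≤ K}.Finite := by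
  refine ((Set.finite_Icc (-⌊K⌋) ⌊K⌋).image (fun z : ℤ => (z : ℝ))).subset ?_
  rintro _ ⟨⟨z, rfl⟩, hz⟩
  refine ⟨z, abs_le.mp (Int.le_floor.mpr ?_), rfl⟩
  exact_mod_cast hz

/-- A set on which a function takes finitely many values contains finitely many elements
representing all of these values. -/
theorem Set.Finite.exists_finset_representatives {α β : Type*} {S : Set α} {f : α → β}
    (h : (f '' S).Finite) :
    ∃ F : Finset α, ∀ a ∈ S, ∃ b ∈ F, b ∈ S ∧ f a = f b := by
  obtain ⟨T, hTS, hT⟩ := (Set.surjOn_image f S).exists_bijOn_subset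
  have hfin : T.Finite := Set.Finite.of_finite_image (hT.image_eq ▸ h) hT.injOn
  refine ⟨hfin.toFinset, fun a ha => ?_⟩
  obtain ⟨b, hb, hab⟩ := hT.surjOn (Set.mem_image_of_mem f ha)
  exact ⟨b, hfin.mem_toFinset.mpr hb, hTS hb, hab.symm⟩

/-- Two matrices with the same products `a_{ij} a_{ji}` and the same cyclic products through
the edges of `G`, based at the roots, are conjugate by a positive diagonal matrix. -/
theorem SimpleGraph.exists_diagonal_conj {V : Type*} {G : SimpleGraph V} {r : V → V}
    (p : ∀ i, G.Walk (r i) i) {A B S : Matrix V V ℝ}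
    (hA : ∀ i j, G.Adj i j → A i j < 0) (hB : ∀ i j, G.Adj i j → B i j < 0)
    (hAS : ∀ i j, G.Adj i j → A i j * A j i = S i j)
    (hBS : ∀ i j, G.Adj i j → B i j * B j i = S i j)
    (hdiag : ∀ i, A i i = B i i)
    (hnonadj : ∀ i j, i ≠ j → ¬ G.Adj i j → A i j = 0 ∧ B i j = 0)
    (hcyc : ∀ i j, G.Adj i j → (p i).weight A * A i j * (p j).reverse.weight A =
      (p i).weight B * B i j * (p j).reverse.weight B) :
    ∃ d : V → ℝ, (∀ i, 0 < d i) ∧ ∀ i j, A i j = d i * B i j * (d j)⁻¹ := by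
  have hd : ∀ i, 0 < (p i).weight B / (p i).weight A := fun i =>
    (p i).weight_div_weight_pos hA hB
  refine ⟨fun i => (p i).weight B / (p i).weight A, hd, fun i j => ?_⟩
  rcases eq_or_ne i j with rfl | hij
  · rw [mul_right_comm, mul_inv_cancel₀ (hd i).ne', one_mul, hdiag]
  by_cases h : G.Adj i j
  · have hA0 := fun k => (p k).weight_ne_zero fun i j h => (hA i j h).ne
    have hB0 := fun k => (p k).weight_ne_zero fun i j h => (hB i j h).ne
    have hrev := (p j).reverse.weight_ne_zero fun i j h => (hA i j h).ne
    have hSj := ((p j).weight_mul_weight_reverse hAS).trans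
      ((p j).weight_mul_weight_reverse hBS).symm
    have hi := hA0 i
    have hj := hA0 j
    have hj' := hB0 j
    have hc := hcyc i j h
    field_simp
    refine mul_right_cancel₀ hrev ?_
    linear_combination (p j).weight B * hc - (p i).weight B * B i j * hSj
  · simp [hnonadj i j hij h]

/-- matrix-level formulation of Theorem 5.1 of the paper.
Fix `N ≥ 4` and symmetric ridge labels `m_{ij} ≥ 2`. Among the `N × N` Cartan
matrices with `a_{ij} a_{ji} = 4cos²(π/m_{ij})` for all `i ≠ j` and all cyclic
products integral, only finitely many equivalence classes (under conjugation by
positive diagonal matrices) occur. -/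
theorem finiteness_of_integral_cartan_matrices
    (N : ℕ) (hN : 4 ≤ N) (m : Fin N → Fin N → ℕ)
    (hsym : ∀ i j, m i j = m j i) (hm : ∀ i j, i ≠ j → 2 ≤ m i j) :
    ∃ F : Finset (Matrix (Fin N) (Fin N) ℝ),
      ∀ A : Matrix (Fin N) (Fin N) ℝ,
        (∀ i, A i i = 2) →
        (∀ i j, i ≠ j → A i j ≤ 0) →
        (∀ i j, A i j = 0 ↔ A j i = 0) →
        (∀ i j, i ≠ j → A i j * A j i = 4 * Real.cos (Real.pi / m i j) ^ 2) →
        (∀ (k : ℕ) (C : Fin (k + 1) → Fin N), ∃ z : ℤ,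
          (∏ j : Fin (k + 1), A (C j) (C (j + 1))) = z) →
        ∃ B ∈ F, ∃ d : Fin N → ℝ, (∀ i, 0 < d i) ∧
          ∀ i j, A i j = d i * B i j * (d j)⁻¹ := by
  classical
  let S : Matrix (Fin N) (Fin N) ℝ := fun i j => 4 * Real.cos (Real.pi / m i j) ^ 2
  let G : SimpleGraph (Fin N) :=
    { Adj := fun i j => i ≠ j ∧ S i j ≠ 0
      symm := ⟨fun i j h => ⟨h.1.symm, by simpa only [S, hsym j i] using h.2⟩⟩
      loopless := ⟨fun i h => h.1 rfl⟩ }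
  obtain ⟨r, p, hr⟩ := G.exists_root_walks
  let T : Set (Matrix (Fin N) (Fin N) ℝ) := {A | (∀ i, A i i = 2) ∧
    (∀ i j, G.Adj i j → A i j < 0) ∧ (∀ i j, i ≠ j → ¬ G.Adj i j → A i j = 0) ∧
    (∀ i j, G.Adj i j → A i j * A j i = S i j) ∧
    ∀ (k : ℕ) (C : Fin (k + 1) → Fin N), ∃ z : ℤ, (∏ j : Fin (k + 1), A (C j) (C (j + 1))) = z}
  let f : Matrix (Fin N) (Fin N) ℝ → Fin N → Fin N → ℝ := fun A i j =>
    if G.Adj i j then (p i).weight A * A i j * (p j).reverse.weight A else 0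
  have hfin : (f '' T).Finite := by
    let K : Fin N → Fin N → ℝ := fun i j => |(p i).weight S * S i j * (p j).weight S|
    refine (Set.Finite.pi' fun i => Set.Finite.pi' fun j =>
      finite_setOf_int_abs_le (K i j)).subset ?_
    rintro _ ⟨A, ⟨-, hneg, -, hS, hint⟩, rfl⟩ i j
    by_cases h : G.Adj i j
    · simp only [f, if_pos h]
      have hne : ∀ i j, G.Adj i j → A i j ≠ 0 := fun i j h => (hneg i j h).ne
      refine ⟨SimpleGraph.Walk.exists_int_weight_mul_edge hint (hr i j h) (p i) h (p j), ?_⟩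
      refine (abs_int_le_mul_of_ne_zero
        (mul_ne_zero (mul_ne_zero ((p j).weight_ne_zero hne) (hne _ _ h.symm))
          ((p i).reverse.weight_ne_zero hne))
        (SimpleGraph.Walk.exists_int_weight_mul_edge hint (hr i j h).symm
          (p j) h.symm (p i))).trans_eq ?_
      simp only [K]
      rw [← (p i).weight_mul_weight_reverse hS, ← (p j).weight_mul_weight_reverse hS, ← hS i j h]
      ring_nf
    · simp only [f, if_neg h]
      exact ⟨⟨0, by simp⟩, by simpa only [abs_zero] using abs_nonneg _⟩
  obtain ⟨F, hF⟩ := hfin.exists_finset_representatives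
  refine ⟨F, fun A hdiag hnonpos hzero hprod hint => ?_⟩
  have hAT : A ∈ T := by
    refine ⟨hdiag, fun i j h => (hnonpos i j h.1).lt_of_ne fun h0 => h.2 ?_, fun i j hij h => ?_,
      fun i j h => hprod i j h.1, hint⟩
    · rw [← show A i j * A j i = S i j from hprod i j h.1, h0, zero_mul]
    · have hS0 : S i j = 0 := not_not.mp fun h0 => h ⟨hij, h0⟩
      rcases mul_eq_zero.mp ((hprod i j hij).trans hS0) with h0 | h0
      · exact h0
      · exact (hzero i j).mpr h0
  obtain ⟨B, hBF, hBT, hAB⟩ := hF A hAT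
  obtain ⟨hA1, hA2, hA3, hA4, -⟩ := hAT
  obtain ⟨hB1, hB2, hB3, hB4, -⟩ := hBT
  refine ⟨B, hBF, SimpleGraph.exists_diagonal_conj p hA2 hB2 hA4 hB4
    (fun i => (hA1 i).trans (hB1 i).symm) (fun i j hij h => ⟨hA3 i j hij h, hB3 i j hij h⟩)
    fun i j h => ?_⟩
  simpa only [f, if_pos h] using congrFun (congrFun hAB i) j
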